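/- arXiv:math/0701441 — 2 statements merged into one kernel-verified Lean document; each statement's English description precedes it below -/
import Mathlib

section
/- The three cubic forms in six variables over ℚ, P₁ = y₁²y₄ − y₂²y₅ + y₃²y₆ − y₁y₂y₃, P₂ = y₁²y₄ − y₂y₃y₅ + y₃²y₆ − y₁y₃², and P₃ = y₁y₃y₄ − y₂y₃y₅ + y₃²y₆ − y₃³, are pairwise non-equivalent: for no pair of them do there exist a nonzero scalar a ∈ ℚ and an invertible linear change of variables yᵢ ↦ Σⱼ b₍ij₎ yⱼ (with (b₍ij₎) an invertible 6×6 matrix over ℚ) transforming one form into a times the other. -/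
/-!
STATEMENT 14: The three cubic forms in six variables over `ℚ`,
`P₁ = y₁²y₄ − y₂²y₅ + y₃²y₆ − y₁y₂y₃`,
`P₂ = y₁²y₄ − y₂y₃y₅ + y₃²y₆ − y₁y₃²`,
`P₃ = y₁y₃y₄ − y₂y₃y₅ + y₃²y₆ − y₃³`,
are pairwise non-equivalent: no nonzero scalar multiple combined with an
invertible linear change of variables transforms one into another.
(Variables `y₁,…,y₆` are `X 0, …, X 5`.)
-/

open MvPolynomial

/-- `kEquiv f g`: `f` is obtained from `g` by a nonzero scalar `a` and an
invertible linear change of variables given by an invertible matrix `B`,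
i.e. `f(y) = a · g(y′)` where `yᵢ′ = Σⱼ B i j • yⱼ`. -/
def kEquiv (f g : MvPolynomial (Fin 6) ℚ) : Prop :=
  ∃ (a : ℚ) (B : Matrix (Fin 6) (Fin 6) ℚ), a ≠ 0 ∧ IsUnit B ∧
    f = C a * aeval (fun i : Fin 6 => ∑ j : Fin 6, C (B i j) * X j) g

noncomputable def P₁ : MvPolynomial (Fin 6) ℚ :=
  X 0 ^ 2 * X 3 - X 1 ^ 2 * X 4 + X 2 ^ 2 * X 5 - X 0 * X 1 * X 2

noncomputable def P₂ : MvPolynomial (Fin 6) ℚ :=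
  X 0 ^ 2 * X 3 - X 1 * X 2 * X 4 + X 2 ^ 2 * X 5 - X 0 * X 2 ^ 2

noncomputable def P₃ : MvPolynomial (Fin 6) ℚ :=
  X 0 * X 2 * X 3 - X 1 * X 2 * X 4 + X 2 ^ 2 * X 5 - X 2 ^ 3

open Module in
/-- A set that contains the standard basis vectors indexed by `I`, and all of whose elements are
supported on `I`, spans a subspace of dimension `#I`. -/
theorem finrank_span_eq_card_of_support {K ι : Type*} [Field K] [Fintype ι] [DecidableEq ι]
    (S : Set (ι → K)) (I : Finset ι) (hI : ∀ i ∈ I, Pi.single i 1 ∈ S)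
    (hS : ∀ v ∈ S, ∀ i ∉ I, v i = 0) : finrank K (Submodule.span K S) = I.card := by
  have h : Submodule.span K S =
      Submodule.span K (Set.range fun i : I => (Pi.single (i : ι) 1 : ι → K)) := by
    apply le_antisymm
    · refine Submodule.span_le.2 fun v hv => ?_
      rw [SetLike.mem_coe, pi_eq_sum_univ' v]
      refine Submodule.sum_mem _ fun i _ => ?_
      by_cases hi : i ∈ I
      · refine Submodule.smul_mem _ _ (Submodule.subset_span ⟨⟨i, hi⟩, ?_⟩)
        ext j
        simp [Pi.single_apply, eq_comm]
      · simp [hS v hv i hi]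
    · refine Submodule.span_mono ?_
      rintro _ ⟨i, rfl⟩
      exact hI i i.2
  have hli : LinearIndependent K fun i : I => (Pi.single (i : ι) 1 : ι → K) :=
    (Pi.linearIndependent_single_one ι K).comp _ Subtype.val_injective
  rw [h, finrank_span_eq_card hli, Fintype.card_coe]

/-- The derivative of `f` at `v` in the direction `w`, computed over the dual numbers. -/
noncomputable def dirDeriv (f : MvPolynomial (Fin 6) ℚ) (v w : Fin 6 → ℚ) : ℚ :=
  (aeval (fun i => (TrivSqZeroExt.inl (v i) + TrivSqZeroExt.inr (w i) : DualNumber ℚ)) f).snd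

/-- The set of points at which all directional derivatives of `f` vanish. -/
def singularSet (f : MvPolynomial (Fin 6) ℚ) : Set (Fin 6 → ℚ) :=
  {v | ∀ w, dirDeriv f v w = 0}

theorem dirDeriv_C_mul_aeval (a : ℚ) (B : Matrix (Fin 6) (Fin 6) ℚ)
    (g : MvPolynomial (Fin 6) ℚ) (v w : Fin 6 → ℚ) :
    dirDeriv (C a * aeval (fun i : Fin 6 => ∑ j : Fin 6, C (B i j) * X j) g) v w =
      a * dirDeriv g (B.mulVec v) (B.mulVec w) := by
  unfold dirDeriv
  rw [map_mul, ← AlgHom.comp_apply, comp_aeval, algHom_C, ← Algebra.smul_def,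
    TrivSqZeroExt.snd_smul, smul_eq_mul]
  congr 4
  ext i : 1
  simp only [map_sum, map_mul, algHom_C, aeval_X, ← Algebra.smul_def]
  ext <;> simp [Matrix.mulVec, dotProduct, TrivSqZeroExt.fst_sum, TrivSqZeroExt.snd_sum]

/-- The dimension of the span of the singular set is invariant under equivalence. -/
theorem kEquiv.finrank_span_singularSet_eq {f g : MvPolynomial (Fin 6) ℚ} (h : kEquiv f g) :
    Module.finrank ℚ (Submodule.span ℚ (singularSet f)) =
      Module.finrank ℚ (Submodule.span ℚ (singularSet g)) := by
  obtain ⟨a, B, ha, hB, rfl⟩ := h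
  let e : (Fin 6 → ℚ) ≃ₗ[ℚ] (Fin 6 → ℚ) := LinearEquiv.ofBijective B.mulVecLin
    ⟨Matrix.mulVec_injective_iff_isUnit.2 hB, Matrix.mulVec_surjective_iff_isUnit.2 hB⟩
  have he : ∀ v, e v = B.mulVec v := fun _ => rfl
  have hS : e '' singularSet (C a * aeval (fun i : Fin 6 => ∑ j : Fin 6, C (B i j) * X j) g) =
      singularSet g := by
    ext v
    obtain ⟨v, rfl⟩ := e.surjective v
    rw [e.injective.mem_set_image]
    simp only [singularSet, Set.mem_ofPred_eq, dirDeriv_C_mul_aeval, mul_eq_zero, ha, false_or, ← he]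
    exact (e.surjective.forall (p := fun w => dirDeriv g (e v) w = 0)).symm
  rw [← hS, ← LinearEquiv.coe_coe, Submodule.span_image, LinearEquiv.finrank_map_eq]

theorem finrank_span_singularSet_P₁ :
    Module.finrank ℚ (Submodule.span ℚ (singularSet P₁)) = 3 := by
  refine finrank_span_eq_card_of_support _ {3, 4, 5} ?_ ?_
  · intro i hi w
    fin_cases hi <;> simp [dirDeriv, P₁, pow_two]
  · intro v hv i hi
    have h3 := hv (Pi.single 3 1)
    have h4 := hv (Pi.single 4 1)
    have h5 := hv (Pi.single 5 1)
    simp [dirDeriv, P₁, pow_two] at h3 h4 h5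
    fin_cases i <;> simp_all

theorem finrank_span_singularSet_P₂ :
    Module.finrank ℚ (Submodule.span ℚ (singularSet P₂)) = 4 := by
  refine finrank_span_eq_card_of_support _ {1, 3, 4, 5} ?_ ?_
  · intro i hi w
    fin_cases hi <;> simp [dirDeriv, P₂, pow_two]
  · intro v hv i hi
    have h3 := hv (Pi.single 3 1)
    have h5 := hv (Pi.single 5 1)
    simp [dirDeriv, P₂, pow_two] at h3 h5
    fin_cases i <;> simp_all

theorem finrank_span_singularSet_P₃ :
    Module.finrank ℚ (Submodule.span ℚ (singularSet P₃)) = 5 := by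
  refine finrank_span_eq_card_of_support _ {0, 1, 3, 4, 5} ?_ ?_
  · intro i hi w
    fin_cases hi <;> simp [dirDeriv, P₃, pow_succ]
  · intro v hv i hi
    have h5 := hv (Pi.single 5 1)
    simp [dirDeriv, P₃, pow_succ] at h5
    fin_cases i <;> simp_all

/-- `P₁`, `P₂`, `P₃` are pairwise non-equivalent cubic forms over `ℚ`. -/
theorem cubic_forms_pairwise_nonequivalent :
    ¬ kEquiv P₁ P₂ ∧ ¬ kEquiv P₂ P₁ ∧
    ¬ kEquiv P₁ P₃ ∧ ¬ kEquiv P₃ P₁ ∧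
    ¬ kEquiv P₂ P₃ ∧ ¬ kEquiv P₃ P₂ := by
  refine ⟨?_, ?_, ?_, ?_, ?_, ?_⟩ <;> intro h <;>
    simpa [finrank_span_singularSet_P₁, finrank_span_singularSet_P₂,
      finrank_span_singularSet_P₃] using h.finrank_span_singularSet_eq
end

section
/- Let L₁, L₂, L₃ be the nilpotent Lie algebras over ℚ presented by generators t₁, t₂, t₃, u₁, u₂, u₃ subject to: all triple brackets of generators vanish (nilpotency class ≤ 2), [tᵢ, uⱼ] = 0 for i ≠ j, and [t₁,u₁] = α₁, [t₂,u₂] = α₂, [t₃,u₃] = α₃, where for L₁: (α₁,α₂,α₃) = ([t₂,t₃], [t₁,t₃], [t₁,t₂]); for L₂: (α₁,α₂,α₃) = ([t₂,t₃], [t₂,t₃], [t₁,t₂]); for L₃: (α₁,α₂,α₃) = ([t₂,t₃], [t₂,t₃], [t₂,t₃]). Then L₁, L₂, L₃ are pairwise non-isomorphic Lie algebras over ℚ. -/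
/-!
STATEMENT 15: Let `L₁, L₂, L₃` be the Lie algebras over `ℚ` presented by
generators `t₁,t₂,t₃,u₁,u₂,u₃` subject to: all triple brackets of generators
vanish, `⁅tᵢ,uⱼ⁆ = 0` for `i ≠ j`, and `⁅tᵢ,uᵢ⁆ = αᵢ`, where
for `L₁`: `(α₁,α₂,α₃) = (⁅t₂,t₃⁆, ⁅t₁,t₃⁆, ⁅t₁,t₂⁆)`;
for `L₂`: `(α₁,α₂,α₃) = (⁅t₂,t₃⁆, ⁅t₂,t₃⁆, ⁅t₁,t₂⁆)`;
for `L₃`: `(α₁,α₂,α₃) = (⁅t₂,t₃⁆, ⁅t₂,t₃⁆, ⁅t₂,t₃⁆)`.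
Then `L₁, L₂, L₃` are pairwise non-isomorphic.
-/

/-- The free Lie algebra over `ℚ` on generators `t₁,t₂,t₃` (`Sum.inl`) and
`u₁,u₂,u₃` (`Sum.inr`). -/
abbrev FL : Type := FreeLieAlgebra ℚ (Fin 3 ⊕ Fin 3)

/-- The generator `tᵢ` (indexed from 0). -/
noncomputable def tg (i : Fin 3) : FL := FreeLieAlgebra.of ℚ (Sum.inl i)

/-- The generator `uⱼ` (indexed from 0). -/
noncomputable def ug (j : Fin 3) : FL := FreeLieAlgebra.of ℚ (Sum.inr j)

/-- The relations: all triple brackets of generators, `⁅tᵢ,uⱼ⁆` for `i ≠ j`, and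
`⁅tᵢ,uᵢ⁆ - αᵢ`. -/
noncomputable def rels (α : Fin 3 → FL) : Set FL :=
  {x | ∃ a b c : Fin 3 ⊕ Fin 3,
      x = ⁅FreeLieAlgebra.of ℚ a, ⁅FreeLieAlgebra.of ℚ b, FreeLieAlgebra.of ℚ c⁆⁆} ∪
  {x | ∃ i j : Fin 3, i ≠ j ∧ x = ⁅tg i, ug j⁆} ∪
  {x | ∃ i : Fin 3, x = ⁅tg i, ug i⁆ - α i}

/-- The presented Lie algebra: the quotient of the free Lie algebra by the Lie
ideal generated by the relations. -/
noncomputable def LA (α : Fin 3 → FL) : Type :=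
  FL ⧸ LieSubmodule.lieSpan ℚ FL (rels α)

noncomputable instance (α : Fin 3 → FL) : LieRing (LA α) := by delta LA; infer_instance
noncomputable instance (α : Fin 3 → FL) : LieAlgebra ℚ (LA α) := by delta LA; infer_instance

/-- `(α₁,α₂,α₃)` for `L₁` (with `t₁,t₂,t₃ = tg 0, tg 1, tg 2`). -/
noncomputable def α₁ : Fin 3 → FL := ![⁅tg 1, tg 2⁆, ⁅tg 0, tg 2⁆, ⁅tg 0, tg 1⁆]

/-- `(α₁,α₂,α₃)` for `L₂`. -/
noncomputable def α₂ : Fin 3 → FL := ![⁅tg 1, tg 2⁆, ⁅tg 1, tg 2⁆, ⁅tg 0, tg 1⁆]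

/-- `(α₁,α₂,α₃)` for `L₃`. -/
noncomputable def α₃ : Fin 3 → FL := ![⁅tg 1, tg 2⁆, ⁅tg 1, tg 2⁆, ⁅tg 1, tg 2⁆]

/-- The bracket `Λ²V → [L, L]` of the two-step nilpotent Lie algebra with `[tᵢ, uᵢ] = ∑ₖ Nᵢₖ aₖ`,
where `(a₀, a₁, a₂) = ([t₂, t₃], [t₁, t₃], [t₁, t₂])`, in the coordinates
`a₀, a₁, a₂, [u₁, u₂], [u₁, u₃], [u₂, u₃]`. -/
def bracketForm (N : Fin 3 → Fin 3 → ℚ) :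
    (Fin 3 ⊕ Fin 3 → ℚ) →ₗ[ℚ] (Fin 3 ⊕ Fin 3 → ℚ) →ₗ[ℚ] (Fin 6 → ℚ) :=
  LinearMap.mk₂ ℚ (fun x y =>
    let wedge := fun i j => x i * y j - x j * y i
    let mixed := fun k => ∑ i, N i k * wedge (.inl i) (.inr i)
    ![wedge (.inl 1) (.inl 2) + mixed 0, wedge (.inl 0) (.inl 2) + mixed 1,
      wedge (.inl 0) (.inl 1) + mixed 2,
      wedge (.inr 0) (.inr 1), wedge (.inr 0) (.inr 2), wedge (.inr 1) (.inr 2)])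
    (by intro x x' y; ext k; fin_cases k <;> simp [Fin.sum_univ_three] <;> ring)
    (by intro c x y; ext k; fin_cases k <;> simp [Fin.sum_univ_three] <;> ring)
    (by intro x y y'; ext k; fin_cases k <;> simp [Fin.sum_univ_three] <;> ring)
    (by intro c x y; ext k; fin_cases k <;> simp [Fin.sum_univ_three] <;> ring)

lemma bracketForm_self (N : Fin 3 → Fin 3 → ℚ) (x : Fin 3 ⊕ Fin 3 → ℚ) :
    bracketForm N x x = 0 := by
  ext k
  fin_cases k <;> simp [bracketForm, Fin.sum_univ_three] <;> ring

/-- The two-step nilpotent Lie algebra `V × W` with bracket `bracketForm N`. -/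
def TwoStep (_N : Fin 3 → Fin 3 → ℚ) : Type := (Fin 3 ⊕ Fin 3 → ℚ) × (Fin 6 → ℚ)

namespace TwoStep

variable {N : Fin 3 → Fin 3 → ℚ}

instance : AddCommGroup (TwoStep N) :=
  inferInstanceAs (AddCommGroup ((Fin 3 ⊕ Fin 3 → ℚ) × (Fin 6 → ℚ)))

instance : Module ℚ (TwoStep N) :=
  inferInstanceAs (Module ℚ ((Fin 3 ⊕ Fin 3 → ℚ) × (Fin 6 → ℚ)))

/-- The projection to the abelianization. -/
def proj : TwoStep N →ₗ[ℚ] (Fin 3 ⊕ Fin 3 → ℚ) := LinearMap.fst ℚ _ _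

/-- The inclusion of the derived subalgebra. -/
def incl : (Fin 6 → ℚ) →ₗ[ℚ] TwoStep N := LinearMap.inr ℚ _ _

lemma incl_injective : Function.Injective (incl : (Fin 6 → ℚ) →ₗ[ℚ] TwoStep N) :=
  LinearMap.inr_injective

@[simp]
lemma proj_incl (w : Fin 6 → ℚ) : proj (incl w : TwoStep N) = 0 := rfl

instance : Bracket (TwoStep N) (TwoStep N) := ⟨fun x y => incl (bracketForm N (proj x) (proj y))⟩

/-- The standard generators. -/
def gen (i : Fin 3 ⊕ Fin 3) : TwoStep N :=
  ((Pi.single i 1, 0) : (Fin 3 ⊕ Fin 3 → ℚ) × (Fin 6 → ℚ))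

@[simp]
lemma proj_gen (i : Fin 3 ⊕ Fin 3) : proj (gen i : TwoStep N) = Pi.single i 1 := rfl

lemma bracket_def (x y : TwoStep N) : ⁅x, y⁆ = incl (bracketForm N (proj x) (proj y)) := rfl

instance : LieRing (TwoStep N) where
  add_lie x y z := by simp [bracket_def]
  lie_add x y z := by simp [bracket_def]
  lie_self x := by simp [bracket_def, bracketForm_self]
  leibniz_lie x y z := by simp [bracket_def]

instance : LieAlgebra ℚ (TwoStep N) where
  lie_smul c x y := by simp [bracket_def]

end TwoStep

/-- The canonical map from the free Lie algebra. -/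
noncomputable def LA.mk (α : Fin 3 → FL) : FL →ₗ⁅ℚ⁆ LA α where
  toFun := LieSubmodule.Quotient.mk (N := LieSubmodule.lieSpan ℚ FL (rels α))
  map_add' _ _ := rfl
  map_smul' _ _ := rfl
  map_lie' := rfl

lemma LA.mk_surjective (α : Fin 3 → FL) : Function.Surjective (LA.mk α) :=
  LieSubmodule.Quotient.surjective_mk' (LieSubmodule.lieSpan ℚ FL (rels α))

lemma LA.mk_eq_zero (α : Fin 3 → FL) {x : FL} :
    LA.mk α x = 0 ↔ x ∈ LieSubmodule.lieSpan ℚ FL (rels α) :=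
  LieSubmodule.Quotient.mk_eq_zero' (N := LieSubmodule.lieSpan ℚ FL (rels α))

/-- A homomorphism out of the free Lie algebra which kills the relations factors through `LA α`. -/
lemma LA.exists_factor {L : Type*} [LieRing L] [LieAlgebra ℚ L] (α : Fin 3 → FL)
    (F : FL →ₗ⁅ℚ⁆ L) (hF : ∀ r ∈ rels α, F r = 0) :
    ∃ f : LA α →ₗ⁅ℚ⁆ L, ∀ x, f (LA.mk α x) = F x := by
  have hker : LieSubmodule.lieSpan ℚ FL (rels α) ≤ F.ker :=
    LieSubmodule.lieSpan_le.2 fun r hr => by simpa using hF r hr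
  have key : ∀ x y, LA.mk α x = LA.mk α y → F x = F y := fun x y h => by
    have h' : x - y ∈ F.ker := hker ((LA.mk_eq_zero α).1 (by rw [map_sub, h, sub_self]))
    rw [LieHom.mem_ker, map_sub] at h'
    exact sub_eq_zero.1 h'
  have hs : ∀ x, F (Function.surjInv (LA.mk_surjective α) (LA.mk α x)) = F x := fun x =>
    key _ _ (Function.surjInv_eq _ _)
  refine ⟨{ toFun := fun a => F (Function.surjInv (LA.mk_surjective α) a)
            map_add' := ?_, map_smul' := ?_, map_lie' := ?_ }, hs⟩
  · intro a b
    obtain ⟨x, rfl⟩ := LA.mk_surjective α a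
    obtain ⟨y, rfl⟩ := LA.mk_surjective α b
    rw [← map_add, hs, hs, hs, map_add]
  · intro c a
    obtain ⟨x, rfl⟩ := LA.mk_surjective α a
    rw [← map_smul, hs, hs, map_smul, RingHom.id_apply]
  · intro a b
    obtain ⟨x, rfl⟩ := LA.mk_surjective α a
    obtain ⟨y, rfl⟩ := LA.mk_surjective α b
    rw [← LieHom.map_lie, hs, hs, hs, LieHom.map_lie]

/-- The homomorphism from the free Lie algebra to `TwoStep N` sending generators to the standard
basis. -/
noncomputable def toTwoStep (N : Fin 3 → Fin 3 → ℚ) : FL →ₗ⁅ℚ⁆ TwoStep N :=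
  FreeLieAlgebra.lift ℚ TwoStep.gen

lemma proj_toTwoStep_of (N : Fin 3 → Fin 3 → ℚ) (i : Fin 3 ⊕ Fin 3) :
    TwoStep.proj (toTwoStep N (FreeLieAlgebra.of ℚ i)) = Pi.single i 1 := by
  rw [toTwoStep, FreeLieAlgebra.lift_of_apply, TwoStep.proj_gen]

lemma proj_toTwoStep_surjective (N : Fin 3 → Fin 3 → ℚ) (v : Fin 3 ⊕ Fin 3 → ℚ) :
    ∃ x, TwoStep.proj (toTwoStep N x) = v := by
  refine ⟨∑ i, v i • FreeLieAlgebra.of ℚ i, ?_⟩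
  ext (j | j) <;> simp [proj_toTwoStep_of, Finset.sum_apply, Pi.single_apply]

/-- The images of the generators under a homomorphism from the free Lie algebra onto the
abelianization of `TwoStep N` span it and are linearly independent. -/
lemma span_and_linearIndependent_proj_of {N : Fin 3 → Fin 3 → ℚ} (F : FL →ₗ⁅ℚ⁆ TwoStep N)
    (hF : ∀ v, ∃ x, TwoStep.proj (F x) = v) :
    (⊤ ≤ Submodule.span ℚ (Set.range fun i => TwoStep.proj (F (FreeLieAlgebra.of ℚ i)))) ∧
      LinearIndependent ℚ fun i => TwoStep.proj (F (FreeLieAlgebra.of ℚ i)) := by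
  set e := fun i => TwoStep.proj (F (FreeLieAlgebra.of ℚ i)) with he
  let S : LieSubalgebra ℚ FL :=
    { (Submodule.span ℚ (Set.range e)).comap (TwoStep.proj ∘ₗ (F : FL →ₗ[ℚ] TwoStep N)) with
      lie_mem' := by
        intro x y _ _
        simp [TwoStep.bracket_def] }
  have hS : ∀ x, x ∈ S ↔ TwoStep.proj (F x) ∈ Submodule.span ℚ (Set.range e) := fun _ => Iff.rfl
  let G : FL →ₗ⁅ℚ⁆ S := FreeLieAlgebra.lift ℚ fun i =>
    ⟨FreeLieAlgebra.of ℚ i, (hS _).2 (Submodule.subset_span ⟨i, rfl⟩)⟩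
  have hG : S.incl.comp G = LieHom.id :=
    FreeLieAlgebra.hom_ext fun i => by simp [G]
  have hspan : ⊤ ≤ Submodule.span ℚ (Set.range e) := by
    rintro v -
    obtain ⟨x, rfl⟩ := hF v
    have hx : ((G x : S) : FL) = x := LieHom.congr_fun hG x
    exact (hS x).1 (hx ▸ (G x).2)
  exact ⟨hspan, linearIndependent_of_top_le_span_of_card_eq_finrank hspan (by simp)⟩

/-- The image of `y ↦ bracketForm N x y` is contained in the span of two vectors. -/
def RankLeTwo (N : Fin 3 → Fin 3 → ℚ) (x : Fin 3 ⊕ Fin 3 → ℚ) : Prop :=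
  ∃ A B : Fin 6 → ℚ, ∀ y, ∃ c d : ℚ, bracketForm N x y = c • A + d • B

lemma RankLeTwo.minor_eq_zero {N : Fin 3 → Fin 3 → ℚ} {x : Fin 3 ⊕ Fin 3 → ℚ}
    (h : RankLeTwo N x) (p q r : Fin 3 ⊕ Fin 3) (i j k : Fin 6) :
    Matrix.det !![
      bracketForm N x (Pi.single p 1) i, bracketForm N x (Pi.single p 1) j,
        bracketForm N x (Pi.single p 1) k;
      bracketForm N x (Pi.single q 1) i, bracketForm N x (Pi.single q 1) j,
        bracketForm N x (Pi.single q 1) k;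
      bracketForm N x (Pi.single r 1) i, bracketForm N x (Pi.single r 1) j,
        bracketForm N x (Pi.single r 1) k] = 0 := by
  obtain ⟨A, B, h⟩ := h
  obtain ⟨a, a', ha⟩ := h (Pi.single p 1)
  obtain ⟨b, b', hb⟩ := h (Pi.single q 1)
  obtain ⟨c, c', hc⟩ := h (Pi.single r 1)
  rw [ha, hb, hc, Matrix.det_fin_three]
  simp
  ring

/-- The structure constants of `L₁`. -/
def N₁ : Fin 3 → Fin 3 → ℚ := ![![1, 0, 0], ![0, 1, 0], ![0, 0, 1]]

/-- The structure constants of `L₂`. -/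
def N₂ : Fin 3 → Fin 3 → ℚ := ![![1, 0, 0], ![1, 0, 0], ![0, 0, 1]]

lemma RankLeTwo.eq_zero_of_N₁ {x : Fin 3 ⊕ Fin 3 → ℚ} (h : RankLeTwo N₁ x) : x = 0 := by
  have p0 := h.minor_eq_zero (.inl 0) (.inr 1) (.inr 2) 0 3 4
  have p1 := h.minor_eq_zero (.inl 1) (.inr 0) (.inr 2) 1 3 5
  have p2 := h.minor_eq_zero (.inl 2) (.inr 0) (.inr 1) 2 4 5
  simp [Matrix.det_fin_three, bracketForm, N₁, Fin.sum_univ_three] at p0 p1 p2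
  have x0 := h.minor_eq_zero (.inr 0) (.inl 1) (.inl 2) 0 2 1
  have x1 := h.minor_eq_zero (.inr 1) (.inl 0) (.inl 2) 1 2 0
  have x2 := h.minor_eq_zero (.inr 2) (.inl 0) (.inl 1) 2 1 0
  simp [Matrix.det_fin_three, bracketForm, N₁, Fin.sum_univ_three,
    p0, p1, p2] at x0 x1 x2
  ext i
  rcases i with i | i <;> fin_cases i <;> simp [*]

lemma RankLeTwo.eq_single_of_N₂ {x : Fin 3 ⊕ Fin 3 → ℚ} (h : RankLeTwo N₂ x) :
    x = Pi.single (.inl 1) (x (.inl 1)) := by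
  have p0 := h.minor_eq_zero (.inl 0) (.inr 1) (.inr 2) 0 3 4
  have p2 := h.minor_eq_zero (.inl 2) (.inr 0) (.inr 1) 2 4 5
  simp [Matrix.det_fin_three, bracketForm, N₂, Fin.sum_univ_three] at p0 p2
  have x0 := h.minor_eq_zero (.inr 0) (.inl 1) (.inl 2) 0 2 1
  have p1 := h.minor_eq_zero (.inl 1) (.inr 0) (.inr 2) 0 3 5
  have x1 := h.minor_eq_zero (.inr 2) (.inl 0) (.inl 1) 2 1 0
  have x2 := h.minor_eq_zero (.inl 0) (.inr 0) (.inr 2) 1 3 5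
  simp [Matrix.det_fin_three, bracketForm, N₂, Fin.sum_univ_three,
    p0, p2] at x0 x1 x2 p1
  have hx2 : x (.inl 2) = 0 := by
    rcases x2 with h0 | h0
    · exact h0
    · rcases x1 with h1 | h1 <;> linarith
  have hp1 : x (.inr 1) = 0 := by
    rcases p1 with h0 | h0 <;> linarith
  ext i
  rcases i with i | i <;> fin_cases i <;> simp [*]

lemma bracketForm_eq_of_lie_eq {N : Fin 3 → Fin 3 → ℚ} {x y x' y' : TwoStep N}
    (h : ⁅x, y⁆ = ⁅x', y'⁆) :
    bracketForm N (TwoStep.proj x) (TwoStep.proj y) =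
      bracketForm N (TwoStep.proj x') (TwoStep.proj y') :=
  TwoStep.incl_injective h

lemma rankLeTwo_of_span {N : Fin 3 → Fin 3 → ℚ} {e : Fin 3 ⊕ Fin 3 → Fin 3 ⊕ Fin 3 → ℚ}
    (he : ⊤ ≤ Submodule.span ℚ (Set.range e)) (x : Fin 3 ⊕ Fin 3 → ℚ) (A B : Fin 6 → ℚ)
    (h : ∀ i, bracketForm N x (e i) ∈ Submodule.span ℚ {A, B}) : RankLeTwo N x := by
  have hle : Submodule.span ℚ (Set.range e) ≤
      (Submodule.span ℚ {A, B}).comap (bracketForm N x) :=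
    Submodule.span_le.2 (by rintro _ ⟨i, rfl⟩; exact h i)
  refine ⟨A, B, fun y => ?_⟩
  obtain ⟨c, d, hcd⟩ := Submodule.mem_span_pair.1 (hle (he (Submodule.mem_top (x := y))))
  exact ⟨c, d, hcd.symm⟩

/-- If `[tⱼ, uⱼ] = [t₂, t₃]` with `j ∈ {2, 3}`, then `ad tⱼ` has rank at most two. -/
lemma rankLeTwo_of_relations {N : Fin 3 → Fin 3 → ℚ} {β : Fin 3 → FL} (F : FL →ₗ⁅ℚ⁆ TwoStep N)
    (hF : ∀ v, ∃ x, TwoStep.proj (F x) = v) (hrel : ∀ r ∈ rels β, F r = 0) {j : Fin 3}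
    (hj : j ≠ 0) (hβ : β j = ⁅tg 1, tg 2⁆) : RankLeTwo N (TwoStep.proj (F (tg j))) := by
  have hne : ∀ k, j ≠ k →
      bracketForm N (TwoStep.proj (F (tg j))) (TwoStep.proj (F (ug k))) = 0 := fun k hk =>
    TwoStep.incl_injective <| by
      rw [← TwoStep.bracket_def, ← LieHom.map_lie, map_zero]
      exact hrel _ (.inl (.inr ⟨j, k, hk, rfl⟩))
  have hself : bracketForm N (TwoStep.proj (F (tg j))) (TwoStep.proj (F (ug j))) =
      bracketForm N (TwoStep.proj (F (tg 1))) (TwoStep.proj (F (tg 2))) :=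
    bracketForm_eq_of_lie_eq <| by
      rw [← LieHom.map_lie, ← LieHom.map_lie, ← hβ, ← sub_eq_zero, ← map_sub]
      exact hrel _ (.inr ⟨j, rfl⟩)
  refine rankLeTwo_of_span (span_and_linearIndependent_proj_of F hF).1 _
    (bracketForm N (TwoStep.proj (F (tg j))) (TwoStep.proj (F (tg 0))))
    (bracketForm N (TwoStep.proj (F (tg 1))) (TwoStep.proj (F (tg 2)))) ?_
  have hA := Submodule.subset_span (R := ℚ) (Set.mem_insert
    (bracketForm N (TwoStep.proj (F (tg j))) (TwoStep.proj (F (tg 0))))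
    {bracketForm N (TwoStep.proj (F (tg 1))) (TwoStep.proj (F (tg 2)))})
  have hB := Submodule.subset_span (R := ℚ) (Set.mem_insert_of_mem
    (bracketForm N (TwoStep.proj (F (tg j))) (TwoStep.proj (F (tg 0))))
    (Set.mem_singleton (bracketForm N (TwoStep.proj (F (tg 1))) (TwoStep.proj (F (tg 2))))))
  rintro (k | k)
  · change bracketForm N _ (TwoStep.proj (F (tg k))) ∈ _
    have hcases : k = 0 ∨ k = j ∨ (j = 1 ∧ k = 2) ∨ (j = 2 ∧ k = 1) := by
      have : ∀ j k : Fin 3, j ≠ 0 → k = 0 ∨ k = j ∨ (j = 1 ∧ k = 2) ∨ (j = 2 ∧ k = 1) := by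
        decide
      exact this j k hj
    obtain rfl | rfl | ⟨rfl, rfl⟩ | ⟨rfl, rfl⟩ := hcases
    · exact hA
    · rw [bracketForm_self]
      exact Submodule.zero_mem _
    · exact hB
    · exact LinearMap.IsAlt.neg (bracketForm_self N) (TwoStep.proj (F (tg 1))) _ ▸
        Submodule.neg_mem _ hB
  · change bracketForm N _ (TwoStep.proj (F (ug k))) ∈ _
    obtain rfl | hk := eq_or_ne j k
    · exact hself ▸ hB
    · rw [hne k hk]
      exact Submodule.zero_mem _

lemma toTwoStep_rels {N : Fin 3 → Fin 3 → ℚ} {α : Fin 3 → FL}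
    (hα : ∀ i, toTwoStep N ⁅tg i, ug i⁆ = toTwoStep N (α i)) :
    ∀ r ∈ rels α, toTwoStep N r = 0 := by
  rintro _ ((⟨a, b, c, rfl⟩ | ⟨i, j, hij, rfl⟩) | ⟨i, rfl⟩)
  · simp [TwoStep.bracket_def]
  · rw [LieHom.map_lie, TwoStep.bracket_def, tg, ug, proj_toTwoStep_of, proj_toTwoStep_of]
    convert map_zero TwoStep.incl
    ext k
    revert hij
    fin_cases i <;> fin_cases j <;> fin_cases k <;> simp [bracketForm, Fin.sum_univ_three]
  · rw [map_sub, hα, sub_self]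

lemma toTwoStep_α₁ (i : Fin 3) : toTwoStep N₁ ⁅tg i, ug i⁆ = toTwoStep N₁ (α₁ i) := by
  fin_cases i <;>
  · simp only [α₁, tg, ug, Matrix.cons_val, Fin.zero_eta, Fin.mk_one, Fin.reduceFinMk,
      LieHom.map_lie, TwoStep.bracket_def, proj_toTwoStep_of]
    congr 1
    ext k
    fin_cases k <;> simp [bracketForm, N₁, Fin.sum_univ_three]

lemma toTwoStep_α₂ (i : Fin 3) : toTwoStep N₂ ⁅tg i, ug i⁆ = toTwoStep N₂ (α₂ i) := by
  fin_cases i <;>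
  · simp only [α₂, tg, ug, Matrix.cons_val, Fin.zero_eta, Fin.mk_one, Fin.reduceFinMk,
      LieHom.map_lie, TwoStep.bracket_def, proj_toTwoStep_of]
    congr 1
    ext k
    fin_cases k <;> simp [bracketForm, N₂, Fin.sum_univ_three]

/-- An isomorphism `LA α ≃ LA β` transports the relations `rels β` to a system of generators of
the concrete model of `LA α`. -/
lemma exists_hom_of_equiv {N : Fin 3 → Fin 3 → ℚ} {α β : Fin 3 → FL}
    (hα : ∀ i, toTwoStep N ⁅tg i, ug i⁆ = toTwoStep N (α i)) (φ : LA α ≃ₗ⁅ℚ⁆ LA β) :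
    ∃ F : FL →ₗ⁅ℚ⁆ TwoStep N,
      (∀ v, ∃ x, TwoStep.proj (F x) = v) ∧ ∀ r ∈ rels β, F r = 0 := by
  obtain ⟨f, hf⟩ := LA.exists_factor α (toTwoStep N) (toTwoStep_rels hα)
  refine ⟨f.comp (φ.symm.toLieHom.comp (LA.mk β)), fun v => ?_, fun r hr => ?_⟩
  · obtain ⟨x, rfl⟩ := proj_toTwoStep_surjective N v
    obtain ⟨y, hy⟩ := LA.mk_surjective β (φ (LA.mk α x))
    refine ⟨y, ?_⟩
    change TwoStep.proj (f (φ.symm (LA.mk β y))) = _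
    rw [hy, LieEquiv.symm_apply_apply, hf]
  · change f (φ.symm (LA.mk β r)) = 0
    rw [(LA.mk_eq_zero β).2 (LieSubmodule.subset_lieSpan hr), map_zero, map_zero]

/-- In `L₁` every element whose `ad` has rank at most two is central, so `L₁` is not isomorphic to
an algebra in which `[t₂, u₂] = [t₂, t₃]`. -/
lemma not_nonempty_equiv_α₁ {β : Fin 3 → FL} (hβ : β 1 = ⁅tg 1, tg 2⁆) :
    ¬ Nonempty (LA α₁ ≃ₗ⁅ℚ⁆ LA β) := by
  rintro ⟨φ⟩
  obtain ⟨F, hF, hrel⟩ := exists_hom_of_equiv toTwoStep_α₁ φ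
  exact (span_and_linearIndependent_proj_of F hF).2.ne_zero (Sum.inl 1)
    (rankLeTwo_of_relations F hF hrel one_ne_zero hβ).eq_zero_of_N₁

/-- The Lie algebras `L₁ = LA α₁`, `L₂ = LA α₂`, `L₃ = LA α₃` are pairwise
non-isomorphic over `ℚ`. -/
theorem lie_algebras_pairwise_nonisomorphic :
    ¬ Nonempty (LA α₁ ≃ₗ⁅ℚ⁆ LA α₂) ∧
    ¬ Nonempty (LA α₁ ≃ₗ⁅ℚ⁆ LA α₃) ∧
    ¬ Nonempty (LA α₂ ≃ₗ⁅ℚ⁆ LA α₃) := by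
  refine ⟨not_nonempty_equiv_α₁ rfl, not_nonempty_equiv_α₁ rfl, ?_⟩
  rintro ⟨φ⟩
  obtain ⟨F, hF, hrel⟩ := exists_hom_of_equiv toTwoStep_α₂ φ
  have h1 := (rankLeTwo_of_relations F hF hrel one_ne_zero rfl).eq_single_of_N₂
  have h2 := (rankLeTwo_of_relations F hF hrel (j := 2) (by decide) rfl).eq_single_of_N₂
  have hli := (span_and_linearIndependent_proj_of F hF).2
  set a := TwoStep.proj (F (tg 1)) (.inl 1)
  set b := TwoStep.proj (F (tg 2)) (.inl 1)
  have hb : b ≠ 0 := fun hb => hli.ne_zero (Sum.inl 2) (h2.trans (by rw [hb, Pi.single_zero]))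
  have hpair : LinearIndependent ℚ ![TwoStep.proj (F (tg 1)), TwoStep.proj (F (tg 2))] := by
    convert hli.comp ![.inl 1, .inl 2] (by decide) using 1
    ext i : 1
    fin_cases i <;> rfl
  refine hb (hpair.eq_zero_of_pair (s := b) (t := -a) ?_).1
  rw [h1, h2, ← Pi.single_smul, ← Pi.single_smul, ← Pi.single_add, smul_eq_mul, smul_eq_mul,
    neg_mul, mul_comm b a, add_neg_cancel, Pi.single_zero]
end
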